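/- arXiv:1302.1995 — 4 statements merged into one kernel-verified Lean document; each statement's English description precedes it below -/
import Mathlib

section
/- Let H be a Hilbert space and let (f_n)_{n ∈ I} be a Bessel sequence of unit vectors in H (indexed by a subset I of ℕ). Suppose that σ := sup_{j ∈ I} ∑_{i ∈ I, i ≠ j} |⟨f_i, f_j⟩| < 1. Then (f_n)_{n ∈ I} is a Riesz sequence. -/
open scoped InnerProductSpace

/-- Schur test: if the off-diagonal column sums of the Gram matrix of finitely many unit vectors
are at most `σ`, then the squared norm of a linear combination differs from the squared `ℓ²` norm
of its coefficients by at most a factor `σ`. -/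
theorem abs_norm_sum_smul_sq_sub_le {ι H : Type*} [DecidableEq ι] [NormedAddCommGroup H]
    [InnerProductSpace ℂ H] (s : Finset ι) (f : ι → H) (c : ι → ℂ) (σ : ℝ)
    (hunit : ∀ i ∈ s, ‖f i‖ = 1)
    (hσ : ∀ j ∈ s, ∑ i ∈ s.erase j, ‖⟪f i, f j⟫_ℂ‖ ≤ σ) :
    |‖∑ k ∈ s, c k • f k‖ ^ 2 - ∑ k ∈ s, ‖c k‖ ^ 2| ≤ σ * ∑ k ∈ s, ‖c k‖ ^ 2 := by
  have expand : ((‖∑ k ∈ s, c k • f k‖ ^ 2 - ∑ k ∈ s, ‖c k‖ ^ 2 : ℝ) : ℂ) =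
      ∑ j ∈ s, ∑ i ∈ s.erase j, ⟪c i • f i, c j • f j⟫_ℂ := by
    have hself : ((‖∑ k ∈ s, c k • f k‖ ^ 2 : ℝ) : ℂ) =
        ∑ j ∈ s, ∑ i ∈ s, ⟪c i • f i, c j • f j⟫_ℂ := by
      have h := inner_self_eq_norm_sq_to_K (𝕜 := ℂ) (∑ k ∈ s, c k • f k)
      rw [inner_sum] at h
      simp only [sum_inner] at h
      rw [h]
      push_cast
      rfl
    rw [Complex.ofReal_sub, hself, Complex.ofReal_sum, ← Finset.sum_sub_distrib]
    refine Finset.sum_congr rfl fun j hj => ?_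
    have hdiag : ⟪c j • f j, c j • f j⟫_ℂ = ((‖c j‖ ^ 2 : ℝ) : ℂ) := by
      rw [inner_self_eq_norm_sq_to_K, norm_smul, hunit j hj, mul_one]
      push_cast
      rfl
    rw [← Finset.add_sum_erase s _ hj, hdiag, add_sub_cancel_left]
  have swap : ∑ j ∈ s, ∑ i ∈ s.erase j, ‖c i‖ ^ 2 * ‖⟪f i, f j⟫_ℂ‖ =
      ∑ j ∈ s, ∑ i ∈ s.erase j, ‖c j‖ ^ 2 * ‖⟪f i, f j⟫_ℂ‖ := by
    rw [Finset.sum_comm' (t' := s) (s' := fun i => s.erase i)]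
    · simp only [norm_inner_symm]
    · intro i j
      simp only [Finset.mem_erase]
      tauto
  have schur : ∑ j ∈ s, ∑ i ∈ s.erase j, ‖c j‖ ^ 2 * ‖⟪f i, f j⟫_ℂ‖ ≤
      σ * ∑ k ∈ s, ‖c k‖ ^ 2 := by
    rw [Finset.mul_sum]
    refine Finset.sum_le_sum fun j hj => ?_
    rw [← Finset.mul_sum, mul_comm]
    exact mul_le_mul_of_nonneg_right (hσ j hj) (sq_nonneg _)
  calc |‖∑ k ∈ s, c k • f k‖ ^ 2 - ∑ k ∈ s, ‖c k‖ ^ 2|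
      = ‖∑ j ∈ s, ∑ i ∈ s.erase j, ⟪c i • f i, c j • f j⟫_ℂ‖ := by
        rw [← expand, Complex.norm_real, Real.norm_eq_abs]
    _ ≤ ∑ j ∈ s, ∑ i ∈ s.erase j, ‖⟪c i • f i, c j • f j⟫_ℂ‖ :=
        (norm_sum_le _ _).trans (Finset.sum_le_sum fun _ _ => norm_sum_le _ _)
    _ ≤ ∑ j ∈ s, ∑ i ∈ s.erase j,
          ((‖c i‖ ^ 2 * ‖⟪f i, f j⟫_ℂ‖) / 2 + (‖c j‖ ^ 2 * ‖⟪f i, f j⟫_ℂ‖) / 2) := by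
        refine Finset.sum_le_sum fun j _ => Finset.sum_le_sum fun i _ => ?_
        rw [inner_smul_left, inner_smul_right, norm_mul, norm_mul, RCLike.norm_conj]
        nlinarith [mul_nonneg (sq_nonneg (‖c i‖ - ‖c j‖)) (norm_nonneg ⟪f i, f j⟫_ℂ)]
    _ = ∑ j ∈ s, ∑ i ∈ s.erase j, ‖c j‖ ^ 2 * ‖⟪f i, f j⟫_ℂ‖ := by
        simp only [Finset.sum_add_distrib, ← Finset.sum_div]
        rw [swap, add_halves]
    _ ≤ σ * ∑ k ∈ s, ‖c k‖ ^ 2 := schur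

/-- **Theorem 1 (Gavruta).** Let `(f n)_{n ∈ I}` be a Bessel sequence of unit vectors in a
Hilbert space `H`, indexed by a subset `I ⊆ ℕ`.  If
`σ := sup_{j ∈ I} ∑_{i ∈ I, i ≠ j} |⟨f i, f j⟩| < 1`
(phrased below as: some `σ < 1` bounds all finite partial sums of these series),
then `(f n)_{n ∈ I}` is a Riesz sequence. -/
theorem feichtinger_stmt0
    {H : Type*} [NormedAddCommGroup H] [InnerProductSpace ℂ H] [CompleteSpace H]
    (I : Set ℕ) (f : ℕ → H)
    (hunit : ∀ n ∈ I, ‖f n‖ = 1)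
    (hBessel : ∃ B > (0 : ℝ), ∀ x : H, ∀ s : Finset ℕ, ↑s ⊆ I →
      ∑ n ∈ s, ‖⟪x, f n⟫_ℂ‖ ^ 2 ≤ B * ‖x‖ ^ 2)
    (hsep : ∃ σ : ℝ, σ < 1 ∧ ∀ j ∈ I, ∀ s : Finset ℕ, ↑s ⊆ I →
      ∑ i ∈ s.erase j, ‖⟪f i, f j⟫_ℂ‖ ≤ σ) :
    ∃ A > (0 : ℝ), ∃ B > (0 : ℝ), ∀ c : ℕ →₀ ℂ, ↑c.support ⊆ I →
      A * ∑ k ∈ c.support, ‖c k‖ ^ 2 ≤ ‖∑ k ∈ c.support, c k • f k‖ ^ 2 ∧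
      ‖∑ k ∈ c.support, c k • f k‖ ^ 2 ≤ B * ∑ k ∈ c.support, ‖c k‖ ^ 2 := by
  obtain ⟨σ, hσ, hsum⟩ := hsep
  refine ⟨1 - σ, sub_pos.mpr hσ, 2, two_pos, fun c hc => ?_⟩
  have h := abs_le.mp <| abs_norm_sum_smul_sq_sub_le c.support f c σ
    (fun i hi => hunit i (hc hi)) (fun j hj => hsum j (hc hj) _ hc)
  have hnonneg : 0 ≤ ∑ k ∈ c.support, ‖c k‖ ^ 2 := Finset.sum_nonneg fun _ _ => sq_nonneg _
  constructor <;> nlinarith [h.1, h.2]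
end

section
/- Let (f_n)_{n ∈ ℕ} be a Bessel sequence of unit vectors in a Hilbert space H. Then ℕ can be partitioned into finitely many subsets I_1, …, I_N such that for each p, the subsequence (f_n)_{n ∈ I_p} is uniformly separated, i.e. sup_{j ∈ I_p} ∑_{i ∈ I_p, i ≠ j} |⟨f_i, f_j⟩|² < 1. -/
open scoped InnerProductSpace

/-- A colouring minimizing the total monochromatic weight spreads the weight at every vertex
evenly: the monochromatic weight at a vertex is at most the average over all colours. -/
lemma exists_coloring_card_mul_sum_le {ι κ : Type*} [Fintype ι] [Fintype κ]
    [DecidableEq κ] [Nonempty κ] (a : ι → ι → ℝ) (hsymm : ∀ i j, a i j = a j i)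
    (hdiag : ∀ i, a i i = 0) :
    ∃ P : ι → κ, ∀ j,
      Fintype.card κ * ∑ i, (if P i = P j then a i j else 0) ≤ ∑ i, a i j := by
  classical
  let E : (ι → κ) → ℝ := fun Q => ∑ i, ∑ k, if Q i = Q k then a i k else 0
  obtain ⟨P, hP⟩ := Finite.exists_min E
  refine ⟨P, fun j => ?_⟩
  let S : κ → ℝ := fun c => ∑ i, if P i = c then a i j else 0
  let R : ℝ := ∑ i ∈ Finset.univ.erase j, ∑ k ∈ Finset.univ.erase j,
    if P i = P k then a i k else 0
  have energy_update : ∀ c, E (Function.update P j c) = R + 2 * S c := by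
    intro c
    have hS : S c = ∑ i ∈ Finset.univ.erase j, if P i = c then a i j else 0 := by
      rw [Finset.sum_erase]
      simp [hdiag]
    have hrow : ∀ i ∈ Finset.univ.erase j,
        (∑ k, if Function.update P j c i = Function.update P j c k then a i k else 0)
          = (if P i = c then a i j else 0)
            + ∑ k ∈ Finset.univ.erase j, if P i = P k then a i k else 0 := by
      intro i hi
      rw [← Finset.add_sum_erase _ _ (Finset.mem_univ j)]
      rw [Function.update_self, Function.update_of_ne (Finset.ne_of_mem_erase hi)]
      congr 1
      refine Finset.sum_congr rfl fun k hk => ?_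
      rw [Function.update_of_ne (Finset.ne_of_mem_erase hk)]
    have hcol : (∑ k, if Function.update P j c j = Function.update P j c k then a j k else 0)
        = S c := by
      rw [hS, ← Finset.add_sum_erase _ _ (Finset.mem_univ j)]
      simp only [hdiag, ite_self, zero_add]
      refine Finset.sum_congr rfl fun k hk => ?_
      rw [Function.update_self, Function.update_of_ne (Finset.ne_of_mem_erase hk), hsymm j k]
      simp only [eq_comm]
    change ∑ i, _ = _
    rw [← Finset.add_sum_erase _ _ (Finset.mem_univ j), hcol, Finset.sum_congr rfl hrow,
      Finset.sum_add_distrib, ← hS]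
    ring
  have hmin : ∀ c, S (P j) ≤ S c := by
    intro c
    have h := hP (Function.update P j c)
    have hself := energy_update (P j)
    rw [Function.update_eq_self] at hself
    rw [energy_update, hself] at h
    linarith
  calc Fintype.card κ * S (P j) = ∑ _c : κ, S (P j) := by simp
    _ ≤ ∑ c, S c := Finset.sum_le_sum fun c _ => hmin c
    _ = ∑ i, a i j := by
      rw [Finset.sum_comm]
      simp

/-- Colourings of the initial segments of `ℕ` have a pointwise limit along an ultrafilter, so a
weight on `ℕ` with bounded row sums admits a colouring with small monochromatic row sums. -/
lemma exists_coloring_nat_card_mul_sum_le {κ : Type*} [Fintype κ] [DecidableEq κ] [Nonempty κ]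
    (a : ℕ → ℕ → ℝ) (hnonneg : ∀ i j, 0 ≤ a i j) (hsymm : ∀ i j, a i j = a j i)
    (hdiag : ∀ i, a i i = 0) (B : ℝ) (hB : ∀ n j, ∑ i ∈ Finset.range n, a i j ≤ B) :
    ∃ P : ℕ → κ, ∀ j, ∀ s : Finset ℕ, (∀ i ∈ s, P i = P j) →
      Fintype.card κ * ∑ i ∈ s, a i j ≤ B := by
  have hfin : ∀ n, ∃ Q : ℕ → κ, ∀ j < n,
      Fintype.card κ * ∑ i ∈ Finset.range n, (if Q i = Q j then a i j else 0) ≤ B := by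
    intro n
    obtain ⟨P, hP⟩ := exists_coloring_card_mul_sum_le (κ := κ) (fun i j : Fin n => a i j)
      (fun i j => hsymm i j) (fun i => hdiag i)
    refine ⟨fun i => if h : i < n then P ⟨i, h⟩ else Classical.arbitrary κ, fun j hj => ?_⟩
    have h := (hP ⟨j, hj⟩).trans
      ((Finset.sum_range fun i => a i j).symm.le.trans (hB n j))
    rw [Finset.sum_range]
    simpa [hj] using h
  choose Q hQ using hfin
  have hlim : ∀ i, ∃ c, ∀ᶠ n in Filter.hyperfilter ℕ, Q n i = c := by
    intro i
    obtain ⟨c, hc⟩ := Ultrafilter.eq_pure_of_finite ((Filter.hyperfilter ℕ).map fun n => Q n i)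
    refine ⟨c, ?_⟩
    have hmem : ({c} : Set κ) ∈ (Filter.hyperfilter ℕ).map fun n => Q n i := by
      rw [hc]
      exact Set.mem_singleton c
    exact hmem
  choose P hP using hlim
  refine ⟨P, fun j s hs => ?_⟩
  have hlarge : ∀ᶠ n in Filter.hyperfilter ℕ, ∀ i ∈ insert j s, i < n ∧ Q n i = P i := by
    rw [Filter.eventually_all_finset]
    intro i _
    exact (Filter.Eventually.filter_mono Nat.hyperfilter_le_atTop
      (Filter.eventually_gt_atTop i)).and (hP i)
  obtain ⟨n, hn⟩ := hlarge.exists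
  have hj := hn j (Finset.mem_insert_self j s)
  refine le_trans ?_ (hQ n j hj.1)
  gcongr
  calc ∑ i ∈ s, a i j = ∑ i ∈ s, if Q n i = Q n j then a i j else 0 := by
        refine Finset.sum_congr rfl fun i hi => ?_
        rw [if_pos]
        rw [(hn i (Finset.mem_insert_of_mem hi)).2, hj.2, hs i hi]
    _ ≤ _ := by
        refine Finset.sum_le_sum_of_subset_of_nonneg (fun i hi => ?_) fun i _ _ => ?_
        · exact Finset.mem_range.2 (hn i (Finset.mem_insert_of_mem hi)).1
        · split_ifs
          exacts [hnonneg i j, le_rfl]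

/-- **Theorem (Gavruta).** Every Bessel sequence of unit vectors in a Hilbert space can be
partitioned into finitely many uniformly separated sequences: there are finitely many pieces
(fibers of `P : ℕ → Fin N`) such that on each piece `p` one has
`sup_{j ∈ I_p} ∑_{i ∈ I_p, i ≠ j} |⟨f i, f j⟩|² < 1`
(phrased below as: some `η < 1` bounds all finite partial sums of these series). -/
theorem feichtinger_stmt2
    {H : Type*} [NormedAddCommGroup H] [InnerProductSpace ℂ H] [CompleteSpace H]
    (f : ℕ → H)
    (hunit : ∀ n, ‖f n‖ = 1)
    (hBessel : ∃ B > (0 : ℝ), ∀ x : H, ∀ s : Finset ℕ,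
      ∑ n ∈ s, ‖⟪x, f n⟫_ℂ‖ ^ 2 ≤ B * ‖x‖ ^ 2) :
    ∃ N : ℕ, ∃ P : ℕ → Fin N, ∀ p : Fin N,
      ∃ η : ℝ, η < 1 ∧ ∀ j : ℕ, P j = p → ∀ s : Finset ℕ, (∀ i ∈ s, P i = p) →
        ∑ i ∈ s.erase j, ‖⟪f i, f j⟫_ℂ‖ ^ 2 ≤ η := by
  obtain ⟨B, hBpos, hB⟩ := hBessel
  obtain ⟨N, hN⟩ := exists_nat_gt (2 * B)
  have hNpos : (0 : ℝ) < N := by linarith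
  have : NeZero N := ⟨by rintro rfl; simp at hNpos⟩
  obtain ⟨P, hP⟩ := exists_coloring_nat_card_mul_sum_le (κ := Fin N)
    (fun i j => if i = j then 0 else ‖⟪f i, f j⟫_ℂ‖ ^ 2)
    (fun i j => by positivity)
    (fun i j => by simp only [eq_comm, norm_inner_symm (f i)])
    (fun i => if_pos rfl) B
    (fun n j => by
      refine le_trans (Finset.sum_le_sum fun i _ => ?_)
        ((hB (f j) (Finset.range n)).trans_eq (by simp [hunit]))
      rw [norm_inner_symm (f j)]
      split_ifs
      exacts [by positivity, le_rfl])
  refine ⟨N, P, fun p => ⟨1 / 2, by norm_num, fun j hj s hs => ?_⟩⟩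
  have h := hP j (s.erase j) fun i hi => (hs i (Finset.mem_of_mem_erase hi)).trans hj.symm
  rw [Finset.sum_congr rfl fun i hi => if_neg (Finset.ne_of_mem_erase hi), Fintype.card_fin] at h
  nlinarith
end

section
/- Let (f_n)_{n ∈ I} be a Bessel sequence of unit vectors in a Hilbert space H with σ := sup_{j ∈ I} ∑_{i ∈ I, i ≠ j} |⟨f_i, f_j⟩| < 1. Then there exists A > 0 such that A ∑ |c_k|² ≤ ‖∑ c_k f_k‖² for every finitely supported family of scalars (c_k)_{k ∈ I}; that is, (f_n)_{n ∈ I} satisfies a lower Riesz bound. -/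
open scoped InnerProductSpace

section

variable {𝕜 E ι : Type*} [RCLike 𝕜] [NormedAddCommGroup E] [InnerProductSpace 𝕜 E]

/-- Schur test for a nonnegative symmetric kernel on a finite set. -/
lemma sum_sum_mul_mul_le_of_symm {s : Finset ι} {a : ι → ι → ℝ} {x : ι → ℝ} {σ : ℝ}
    (ha : ∀ i j, 0 ≤ a i j) (hsymm : ∀ i j, a i j = a j i)
    (hsum : ∀ j ∈ s, ∑ i ∈ s, a i j ≤ σ) :
    ∑ j ∈ s, ∑ i ∈ s, x i * x j * a i j ≤ σ * ∑ j ∈ s, x j ^ 2 := by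
  have hdiag : ∑ j ∈ s, ∑ i ∈ s, x j ^ 2 * a i j ≤ σ * ∑ j ∈ s, x j ^ 2 := by
    rw [Finset.mul_sum]
    refine Finset.sum_le_sum fun j hj => ?_
    rw [← Finset.mul_sum, mul_comm σ]
    exact mul_le_mul_of_nonneg_left (hsum j hj) (sq_nonneg _)
  have hswap : ∑ j ∈ s, ∑ i ∈ s, x i ^ 2 * a i j = ∑ j ∈ s, ∑ i ∈ s, x j ^ 2 * a i j := by
    rw [Finset.sum_comm]
    simp only [fun i j => hsymm i j]
  have hyoung : ∑ j ∈ s, ∑ i ∈ s, 2 * (x i * x j * a i j) ≤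
      ∑ j ∈ s, ∑ i ∈ s, (x i ^ 2 * a i j + x j ^ 2 * a i j) :=
    Finset.sum_le_sum fun j _ => Finset.sum_le_sum fun i _ => by
      nlinarith [mul_nonneg (sq_nonneg (x i - x j)) (ha i j)]
  simp only [Finset.sum_add_distrib, ← Finset.mul_sum] at hyoung hswap hdiag ⊢
  linarith

/-- Lower Riesz bound for finitely many unit vectors with diagonally dominant Gram matrix. -/
lemma one_sub_mul_sum_norm_sq_le_norm_sum_smul_sq [DecidableEq ι] {s : Finset ι} {f : ι → E}
    {σ : ℝ} (hunit : ∀ i ∈ s, ‖f i‖ = 1)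
    (hσ : ∀ j ∈ s, ∑ i ∈ s.erase j, ‖inner 𝕜 (f i) (f j)‖ ≤ σ) (c : ι → 𝕜) :
    (1 - σ) * ∑ k ∈ s, ‖c k‖ ^ 2 ≤ ‖∑ k ∈ s, c k • f k‖ ^ 2 := by
  have hschur : ∑ j ∈ s, ∑ i ∈ s, ‖c i‖ * ‖c j‖ *
      (if i = j then 0 else ‖inner 𝕜 (f i) (f j)‖) ≤ σ * ∑ j ∈ s, ‖c j‖ ^ 2 := by
    refine sum_sum_mul_mul_le_of_symm (fun i j => ?_) (fun i j => ?_) fun j hj => ?_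
    · split_ifs <;> positivity
    · simp only [eq_comm (a := i), norm_inner_symm (f i)]
    · rw [← Finset.add_sum_erase s _ hj, if_pos rfl, zero_add]
      refine le_of_eq_of_le (Finset.sum_congr rfl fun i hi => ?_) (hσ j hj)
      rw [if_neg (Finset.ne_of_mem_erase hi)]
  have hterm : ∀ j ∈ s, ∀ i ∈ s, (if i = j then ‖c j‖ ^ 2 else 0) -
      ‖c i‖ * ‖c j‖ * (if i = j then 0 else ‖inner 𝕜 (f i) (f j)‖) ≤
      RCLike.re (inner 𝕜 (c i • f i) (c j • f j)) := by
    intro j hj i _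
    split_ifs with h
    · subst h
      rw [inner_self_eq_norm_sq, norm_smul, hunit i hj]
      simp
    · have hnorm : ‖inner 𝕜 (c i • f i) (c j • f j)‖ =
          ‖c i‖ * ‖c j‖ * ‖inner 𝕜 (f i) (f j)‖ := by
        rw [inner_smul_left, inner_smul_right, norm_mul, norm_mul, RCLike.norm_conj, mul_assoc]
      rw [← hnorm, zero_sub]
      exact (abs_le.mp (RCLike.abs_re_le_norm _)).1
  have hexpand : ‖∑ k ∈ s, c k • f k‖ ^ 2 =
      ∑ j ∈ s, ∑ i ∈ s, RCLike.re (inner 𝕜 (c i • f i) (c j • f j)) := by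
    rw [← inner_self_eq_norm_sq (𝕜 := 𝕜), inner_sum, map_sum]
    simp only [sum_inner, map_sum]
  have hsum := Finset.sum_le_sum fun j hj => Finset.sum_le_sum (hterm j hj)
  have hdiag : ∑ j ∈ s, ∑ i ∈ s, (if i = j then ‖c j‖ ^ 2 else 0) = ∑ j ∈ s, ‖c j‖ ^ 2 :=
    Finset.sum_congr rfl fun j hj => by rw [Finset.sum_ite_eq' s j, if_pos hj]
  simp only [Finset.sum_sub_distrib] at hsum
  rw [hexpand]
  linarith

end

/-- **Lower Riesz bound (Gavruta).** Let `(f n)_{n ∈ I}` be a Bessel sequence of unit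
vectors in a Hilbert space `H` with
`σ := sup_{j ∈ I} ∑_{i ∈ I, i ≠ j} |⟨f i, f j⟩| < 1`
(phrased below as: some `σ < 1` bounds all finite partial sums of these series).
Then there exists `A > 0` with `A ∑ |c k|² ≤ ‖∑ c k • f k‖²` for every finitely supported
family of scalars supported in `I`. -/
theorem feichtinger_stmt5
    {H : Type*} [NormedAddCommGroup H] [InnerProductSpace ℂ H] [CompleteSpace H]
    (I : Set ℕ) (f : ℕ → H)
    (hunit : ∀ n ∈ I, ‖f n‖ = 1)
    (hBessel : ∃ B > (0 : ℝ), ∀ x : H, ∀ s : Finset ℕ, ↑s ⊆ I →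
      ∑ n ∈ s, ‖⟪x, f n⟫_ℂ‖ ^ 2 ≤ B * ‖x‖ ^ 2)
    (σ : ℝ) (hσ1 : σ < 1)
    (hσ : ∀ j ∈ I, ∀ s : Finset ℕ, ↑s ⊆ I →
      ∑ i ∈ s.erase j, ‖⟪f i, f j⟫_ℂ‖ ≤ σ) :
    ∃ A > (0 : ℝ), ∀ c : ℕ →₀ ℂ, ↑c.support ⊆ I →
      A * ∑ k ∈ c.support, ‖c k‖ ^ 2 ≤ ‖∑ k ∈ c.support, c k • f k‖ ^ 2 := by
  exact ⟨1 - σ, sub_pos.mpr hσ1, fun c hc =>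
    one_sub_mul_sum_norm_sq_le_norm_sum_smul_sq (fun i hi => hunit i (hc hi))
      (fun j hj => hσ j (hc hj) _ hc) c⟩
end

section
/- Let (a_{ij})_{i,j ∈ ℕ} be a family of real numbers with a_{ij} = a_{ji} ≥ 0, a_{ii} = 0 for all i, j, and sup_{j ∈ ℕ} ∑_{i ∈ ℕ} a_{ij} ≤ C for some constant C ≥ 0. Then for every m ≥ 1 there exists a partition of ℕ into 2^m sets I_1, …, I_{2^m} such that sup_{j ∈ I_p} ∑_{i ∈ I_p} a_{ij} ≤ C / 2^m for every p = 1, …, 2^m. -/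
/-- The weight `c` of a pair `i, j`, counted only when both lie in the same part of the colouring `P`,
depends continuously on `P`. -/
lemma continuous_ite_eq_apply {ι κ : Type*} [TopologicalSpace κ] [DiscreteTopology κ]
    [DecidableEq κ] (i j : ι) (c : ℝ) :
    Continuous fun P : ι → κ => if P i = P j then c else 0 :=
  Continuous.comp (g := fun x : κ × κ => if x.1 = x.2 then c else 0)
    (f := fun P : ι → κ => (P i, P j)) continuous_of_discreteTopology
    ((continuous_apply i).prodMk (continuous_apply j))

/-- A colouring minimizing the total weight inside its parts has, at each point, at most the average
weight inside the part of that point. -/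
lemma exists_coloring_sum_le_div {ι : Type*} (a : ι → ι → ℝ)
    (hsymm : ∀ i j, a i j = a j i) (hdiag : ∀ i, a i i = 0) (C : ℝ) (t : Finset ι)
    (hbound : ∀ j ∈ t, ∑ i ∈ t, a i j ≤ C) (k : ℕ) [NeZero k] :
    ∃ P : ι → Fin k, ∀ j ∈ t, ∑ i ∈ t, (if P i = P j then a i j else 0) ≤ C / k := by
  classical
  obtain ⟨P, -, hP⟩ := (isCompact_univ (X := ι → Fin k)).exists_isMinOn Set.univ_nonempty
    (f := fun P => ∑ i ∈ t, ∑ j ∈ t, if P i = P j then a i j else 0)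
    (continuous_finsetSum _ fun i _ => continuous_finsetSum _ fun j _ =>
      continuous_ite_eq_apply i j _).continuousOn
  refine ⟨P, fun j hj => ?_⟩
  obtain ⟨u, hju, rfl⟩ : ∃ u, j ∉ u ∧ insert j u = t :=
    ⟨t.erase j, Finset.notMem_erase j t, Finset.insert_erase hj⟩
  have energy (Q : ι → Fin k) :
      ∑ i ∈ insert j u, ∑ l ∈ insert j u, (if Q i = Q l then a i l else 0) =
        2 * ∑ i ∈ u, (if Q i = Q j then a i j else 0) +
          ∑ i ∈ u, ∑ l ∈ u, (if Q i = Q l then a i l else 0) := by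
    have flip : ∑ l ∈ u, (if Q j = Q l then a j l else 0) =
        ∑ i ∈ u, (if Q i = Q j then a i j else 0) :=
      Finset.sum_congr rfl fun l _ => by simp only [hsymm j l, eq_comm]
    simp only [Finset.sum_insert hju, Finset.sum_add_distrib, flip, hdiag, ite_self]
    ring
  have recolor (q : Fin k) : ∑ i ∈ u, (if P i = P j then a i j else 0) ≤
      ∑ i ∈ u, (if P i = q then a i j else 0) := by
    have h := hP (Set.mem_univ (Function.update P j q))
    simp only [Set.mem_ofPred_eq, energy] at h
    have hu {i : ι} (hi : i ∈ u) : Function.update P j q i = P i :=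
      Function.update_of_ne (ne_of_mem_of_not_mem hi hju) _ _
    have cross : ∑ i ∈ u, (if Function.update P j q i = Function.update P j q j
        then a i j else 0) = ∑ i ∈ u, (if P i = q then a i j else 0) :=
      Finset.sum_congr rfl fun i hi => by rw [hu hi, Function.update_self]
    have inner : ∑ i ∈ u, ∑ l ∈ u, (if Function.update P j q i = Function.update P j q l
        then a i l else 0) = ∑ i ∈ u, ∑ l ∈ u, (if P i = P l then a i l else 0) :=
      Finset.sum_congr rfl fun i hi => Finset.sum_congr rfl fun l hl => by rw [hu hi, hu hl]
    rw [cross, inner] at h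
    linarith
  have total : ∑ q : Fin k, ∑ i ∈ u, (if P i = q then a i j else 0) = ∑ i ∈ u, a i j := by
    rw [Finset.sum_comm]
    simp
  have average := Finset.sum_le_sum fun q (_ : q ∈ Finset.univ) => recolor q
  have row := hbound j hj
  rw [Finset.sum_insert hju, hdiag, zero_add] at row
  rw [total, Finset.sum_const, Finset.card_univ, Fintype.card_fin, nsmul_eq_mul] at average
  rw [le_div_iff₀ (by exact_mod_cast Nat.pos_of_neZero k), Finset.sum_insert hju, hdiag, ite_self,
    zero_add, mul_comm]
  exact average.trans row

/-- Mills' lemma for a partition of `ℕ` into `k` parts. -/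
lemma exists_partition_sum_le_div (a : ℕ → ℕ → ℝ) (hsymm : ∀ i j, a i j = a j i)
    (hnonneg : ∀ i j, 0 ≤ a i j) (hdiag : ∀ i, a i i = 0) (C : ℝ)
    (hbound : ∀ j : ℕ, ∀ s : Finset ℕ, ∑ i ∈ s, a i j ≤ C) (k : ℕ) [NeZero k] :
    ∃ P : ℕ → Fin k, ∀ j : ℕ, ∀ s : Finset ℕ, (∀ i ∈ s, P i = P j) →
      ∑ i ∈ s, a i j ≤ C / k := by
  let K (n : ℕ) : Set (ℕ → Fin k) := {P | ∀ j ∈ Finset.range n,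
    ∑ i ∈ Finset.range n, (if P i = P j then a i j else 0) ≤ C / k}
  have term_nonneg (P : ℕ → Fin k) (i j : ℕ) : 0 ≤ if P i = P j then a i j else 0 := by
    split_ifs
    exacts [hnonneg i j, le_rfl]
  have closed (n : ℕ) : IsClosed (K n) := by
    simp only [K, Set.ofPred_forall]
    exact isClosed_iInter fun j => isClosed_iInter fun _ => isClosed_le
      (continuous_finsetSum _ fun i _ => continuous_ite_eq_apply i j _) continuous_const
  obtain ⟨P, hP⟩ := IsCompact.nonempty_iInter_of_sequence_nonempty_isCompact_isClosed K
    (fun n P hP j hj => (Finset.sum_le_sum_of_subset_of_nonneg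
      (Finset.range_mono n.le_succ) fun i _ _ => term_nonneg P i j).trans
        (hP j (Finset.range_mono n.le_succ hj)))
    (fun n => exists_coloring_sum_le_div a hsymm hdiag C _ (fun j _ => hbound j _) k)
    (closed 0).isCompact closed
  refine ⟨P, fun j s hs => ?_⟩
  obtain ⟨n, hn⟩ := (insert j s).exists_nat_subset_range
  calc ∑ i ∈ s, a i j = ∑ i ∈ s, (if P i = P j then a i j else 0) :=
        Finset.sum_congr rfl fun i hi => (if_pos (hs i hi)).symm
    _ ≤ ∑ i ∈ Finset.range n, (if P i = P j then a i j else 0) :=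
        Finset.sum_le_sum_of_subset_of_nonneg ((Finset.subset_insert j s).trans hn)
          fun i _ _ => term_nonneg P i j
    _ ≤ C / k := Set.mem_iInter.1 hP n j (hn (Finset.mem_insert_self j s))

/-- **Iterated Mills' Lemma.** Let `(a i j)` be a symmetric family of nonnegative reals with
zero diagonal such that all (finite partial) sums `∑_i a i j` are bounded by `C ≥ 0`.
Then for every `m ≥ 1` there is a partition of `ℕ` into `2^m` sets (the fibers of
`P : ℕ → Fin (2^m)`) on each of which the corresponding row sums are bounded by `C / 2^m`. -/
theorem mills_lemma_iterated
    (a : ℕ → ℕ → ℝ)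
    (hsymm : ∀ i j, a i j = a j i)
    (hnonneg : ∀ i j, 0 ≤ a i j)
    (hdiag : ∀ i, a i i = 0)
    (C : ℝ) (hC : 0 ≤ C)
    (hbound : ∀ j : ℕ, ∀ s : Finset ℕ, ∑ i ∈ s, a i j ≤ C) :
    ∀ m : ℕ, 1 ≤ m → ∃ P : ℕ → Fin (2 ^ m), ∀ p : Fin (2 ^ m),
      ∀ j : ℕ, P j = p → ∀ s : Finset ℕ, (∀ i ∈ s, P i = p) →
        ∑ i ∈ s, a i j ≤ C / 2 ^ m := by
  intro m _
  obtain ⟨P, hP⟩ := exists_partition_sum_le_div a hsymm hnonneg hdiag C hbound (2 ^ m)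
  refine ⟨P, fun p j hj s hs => ?_⟩
  simpa using hP j s fun i hi => (hs i hi).trans hj.symm
end
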